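/- Let n and m be natural numbers, let f : ℂ → ℂ be differentiable (entire), and let T : ℂ → Matrix (Fin n) (Fin m) ℂ be a matrix-valued function such that for every pair of indices i, j the entry function z ↦ T(z)_{i,j} is differentiable on ℂ with derivative z ↦ f(z)·T(z)_{i,j}. Then the rank of the matrix T(z) is the same for all z ∈ ℂ; that is, for all z, w ∈ ℂ, rank T(z) = rank T(w). -/

import Mathlib

/-- A projectively flat map of trivialized vector bundles has constant rank:
if every entry of the matrix-valued function `T : ℂ → Matrix (Fin n) (Fin m) ℂ`
satisfies the ODE `(T z i j)' = f z * T z i j` for an entire function `f`,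
then the rank of `T z` is the same for all `z`. -/
theorem rank_constant_of_projectively_flat (n m : ℕ) (f : ℂ → ℂ)
    (hf : Differentiable ℂ f) (T : ℂ → Matrix (Fin n) (Fin m) ℂ)
    (hT : ∀ i j z, HasDerivAt (fun z => T z i j) (f z * T z i j) z) :
    ∀ z w : ℂ, (T z).rank = (T w).rank := by
  intro z w
  obtain ⟨F, hF⟩ := hf.isExactOn_univ
  have key : ∀ i j, Complex.exp (-F z) * T z i j = Complex.exp (-F w) * T w i j := by
    intro i j
    have hd : ∀ x, HasDerivAt (fun x => Complex.exp (-F x) * T x i j) 0 x := by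
      intro x
      have h := ((hF x (Set.mem_univ x)).neg.cexp).mul (hT i j x)
      refine h.congr_deriv ?_
      simp only [Pi.neg_apply]
      ring
    exact is_const_of_deriv_eq_zero (fun x => (hd x).differentiableAt)
      (fun x => (hd x).deriv) z w
  have hM : Complex.exp (-F z) • T z = Complex.exp (-F w) • T w := by
    ext i j
    simpa using key i j
  rw [← Matrix.rank_smul_of_mem_nonZeroDivisors (T z)
      (mem_nonZeroDivisors_of_ne_zero (Complex.exp_ne_zero (-F z))), hM,
    Matrix.rank_smul_of_mem_nonZeroDivisors (T w)
      (mem_nonZeroDivisors_of_ne_zero (Complex.exp_ne_zero (-F w)))]
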